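/- If N = q · n² is an odd perfect number with q prime, q ≡ 1 (mod 4), gcd(q,n) = 1, and n < q, then n < σ(n) ≤ q < σ(q). -/

import Mathlib

open Finset

/-- `p` is the base-`r` repunit with `l` digits, for odd primes `r` and `l`. -/
def IsRepunit (p r l : ℕ) : Prop :=
  r.Prime ∧ r ≠ 2 ∧ l.Prime ∧ l ≠ 2 ∧ p = ∑ i ∈ range l, r ^ i

def smallOddPrimes : List ℕ :=
  [3, 5, 7, 11, 13, 17, 19, 23, 29, 31, 37, 41, 43, 47, 53, 59, 61, 67, 71, 73]

theorem mem_smallOddPrimes {r : ℕ} (h : r.Prime) (h2 : r ≠ 2) (hr : r < 75) :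
    r ∈ smallOddPrimes := by
  have key : ∀ r < 75, r.Prime → r ≠ 2 → r ∈ smallOddPrimes := by decide +kernel
  exact key r hr h h2

theorem repunit_ne_of_mem_smallOddPrimes :
    ∀ r ∈ smallOddPrimes, ∀ s ∈ smallOddPrimes, s < r →
      ∀ k ∈ smallOddPrimes, ∀ l ∈ smallOddPrimes, k < l →
        (s - 1) * (r ^ k - 1) ≠ (r - 1) * (s ^ l - 1) := by
  decide +kernel

theorem Nat.Prime.three_le {r : ℕ} (h : r.Prime) (h2 : r ≠ 2) : 3 ≤ r := by
  have := h.two_le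
  omega

namespace IsRepunit

variable {p r s k l : ℕ}

theorem three_le_base (h : IsRepunit p r l) : 3 ≤ r := h.1.three_le h.2.1

theorem three_le_length (h : IsRepunit p r l) : 3 ≤ l := h.2.2.1.three_le h.2.2.2.1

theorem mul_eq (h : IsRepunit p r l) : (r - 1) * p = r ^ l - 1 := by
  have h3 := h.three_le_base
  zify [show 1 ≤ r by omega, Nat.one_le_pow l r (by omega)]
  rw [← geom_sum_mul, h.2.2.2.2]
  push_cast
  ring

theorem pow_lt (h : IsRepunit p r l) : r ^ (l - 1) < p := by
  have h3 := h.three_le_length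
  obtain ⟨k, rfl⟩ : ∃ k, l = k + 1 := ⟨l - 1, by omega⟩
  rw [h.2.2.2.2, sum_range_succ, Nat.add_sub_cancel]
  have : 0 < ∑ i ∈ range k, r ^ i :=
    sum_pos (fun i _ => pow_pos h.1.pos i) ⟨0, by simp; omega⟩
  omega

theorem base_dvd (h : IsRepunit p r l) : r ∣ p - 1 := by
  have h3 := h.three_le_length
  obtain ⟨k, rfl⟩ : ∃ k, l = k + 1 := ⟨l - 1, by omega⟩
  rw [h.2.2.2.2, sum_range_succ']
  simp only [pow_zero, Nat.add_sub_cancel]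
  exact dvd_sum fun i _ => dvd_pow_self r (by omega)

theorem length_dvd (h : IsRepunit p r l) (hp : p.Prime) : l ∣ p - 1 := by
  have : Fact p.Prime := ⟨hp⟩
  have : Fact l.Prime := ⟨h.2.2.1⟩
  have hpow := h.pow_lt
  have hl3 := h.three_le_length
  have hr3 := h.three_le_base
  have hrp : r < p := lt_of_le_of_lt (Nat.le_self_pow (by omega) r) hpow
  have h1 : (r : ZMod p) ^ l = 1 := by
    have e : r ^ l = (r - 1) * p + 1 := by
      have := h.mul_eq
      have := Nat.one_le_pow l r (by omega)
      omega
    have := congrArg (Nat.cast : ℕ → ZMod p) e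
    push_cast at this
    simpa using this
  have hne : (r : ZMod p) ≠ 1 := by
    intro e
    have : r ≡ 1 [MOD p] := (ZMod.natCast_eq_natCast_iff _ _ _).1 (by simpa using e)
    have := Nat.ModEq.eq_of_lt_of_lt this hrp hp.one_lt
    omega
  have h0 : (r : ZMod p) ≠ 0 := by
    intro e
    have := Nat.le_of_dvd (by omega) ((ZMod.natCast_eq_zero_iff _ _).1 e)
    omega
  rw [← orderOf_eq_prime h1 hne]
  exact ZMod.orderOf_dvd_card_sub_one h0

theorem two_dvd (h : IsRepunit p r l) (hp : p.Prime) : 2 ∣ p - 1 := by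
  have h1 := Nat.le_self_pow (n := l - 1) (by have := h.three_le_length; omega) r
  have h2 := h.pow_lt
  have h3 := h.three_le_base
  exact (Nat.Odd.sub_odd (hp.odd_of_ne_two (by omega)) odd_one).two_dvd

theorem strictMono_base (h : IsRepunit p r k) (h' : IsRepunit p s l) (hsr : s < r) : k < l := by
  by_contra! hlk
  have : p < p := calc
    p = ∑ i ∈ range l, s ^ i := h'.2.2.2.2
    _ < ∑ i ∈ range l, r ^ i := by
      apply sum_lt_sum (fun i _ => Nat.pow_le_pow_left hsr.le i)
      exact ⟨1, by simpa using h'.2.2.1.one_lt, by simpa using hsr⟩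
    _ ≤ ∑ i ∈ range k, r ^ i :=
      sum_le_sum_of_subset (range_mono hlk)
    _ = p := h.2.2.2.2.symm
  omega

theorem base_eq_of_lt (h : IsRepunit p r k) (h' : IsRepunit p s l) (hr : r < 75) (hs : s < 75)
    (hk : k < 75) (hl : l < 75) : r = s := by
  wlog hsr : s < r generalizing r s k l
  · by_contra hne
    exact hne (this h' h hs hr hl hk (by omega)).symm
  exfalso
  refine repunit_ne_of_mem_smallOddPrimes r (mem_smallOddPrimes h.1 h.2.1 hr) s
    (mem_smallOddPrimes h'.1 h'.2.1 hs) hsr k (mem_smallOddPrimes h.2.2.1 h.2.2.2.1 hk) l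
    (mem_smallOddPrimes h'.2.2.1 h'.2.2.2.1 hl) (h.strictMono_base h' hsr) ?_
  rw [← h.mul_eq, ← h'.mul_eq]
  ring

/-- The case of a single repunit representation. -/
theorem single_bound (h : IsRepunit p r l) : 2 * ((l - 1) * (r - 1)) < p + l := by
  have hl3 := h.three_le_length
  have hr3 := h.three_le_base
  have hsum := h.2.2.2.2
  obtain ⟨t, rfl⟩ : ∃ t, r = 1 + t := ⟨r - 1, by omega⟩
  rcases hl3.eq_or_lt with rfl | hl4
  · simp only [sum_range_succ, range_zero, sum_empty] at hsum
    simp only [Nat.add_sub_cancel_left]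
    nlinarith [sq_nonneg ((t : ℤ) - 1)]
  · have hb : ∑ i ∈ range l, (1 + i * t) ≤ p := by
      rw [hsum]
      refine sum_le_sum fun i _ => ?_
      exact_mod_cast one_add_mul_le_pow (a := (t : ℤ)) (by omega) i
    rw [sum_add_distrib, ← sum_mul] at hb
    have hg := Finset.sum_range_id_mul_two l
    simp only [sum_const, card_range, smul_eq_mul, mul_one] at hb
    simp only [Nat.add_sub_cancel_left]
    obtain ⟨u, rfl⟩ : ∃ u, l = u + 4 := ⟨l - 4, by omega⟩
    simp only [show u + 4 - 1 = u + 3 by omega] at *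
    have : 2 * (u + 3) ≤ ∑ i ∈ range (u + 4), i := by nlinarith
    nlinarith [Nat.mul_le_mul_right t this]

end IsRepunit

theorem sum_pred_le {B : Finset ℕ} {M : ℕ} (h : ∀ r ∈ B, r ≤ M) :
    2 * ∑ r ∈ B, (r - 1) ≤ M * (M - 1) := by
  have h1 : ∑ r ∈ B, (r - 1) ≤ ∑ r ∈ range (M + 1), (r - 1) :=
    sum_le_sum_of_subset fun r hr => by have := h r hr; simp; omega
  rw [sum_range_succ'] at h1
  simp only [Nat.add_sub_cancel, Nat.zero_sub, add_zero] at h1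
  have := Finset.sum_range_id_mul_two M
  omega

theorem pow_bound {n : ℕ} (hn : 75 ≤ n) : 4 ^ 7 * n ^ 35 ≤ 9 ^ (n - 1) := by
  induction n, hn using Nat.le_induction with
  | base => norm_num
  | succ n hn ih =>
    obtain ⟨k, rfl⟩ : ∃ k, n = k + 1 := ⟨n - 1, by omega⟩
    simp only [Nat.add_sub_cancel] at *
    have h1 : (75 * (k + 1 + 1)) ^ 35 ≤ (76 * (k + 1)) ^ 35 := Nat.pow_le_pow_left (by omega) 35
    rw [mul_pow, mul_pow] at h1
    have h2 : 75 ^ 35 * (k + 1 + 1) ^ 35 ≤ 75 ^ 35 * (9 * (k + 1) ^ 35) := by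
      refine h1.trans ?_
      rw [← mul_assoc]
      exact Nat.mul_le_mul_right _ (by norm_num)
    have h3 := Nat.le_of_mul_le_mul_left h2 (by norm_num)
    rw [pow_succ 9 k]
    omega

theorem pow_bound' {n : ℕ} (hn : 11 ≤ n) : 2 * n ^ 4 ≤ 3 ^ (n - 1) := by
  induction n, hn using Nat.le_induction with
  | base => norm_num
  | succ n hn ih =>
    obtain ⟨k, rfl⟩ : ∃ k, n = k + 1 := ⟨n - 1, by omega⟩
    simp only [Nat.add_sub_cancel] at *
    have h1 : (11 * (k + 1 + 1)) ^ 4 ≤ (12 * (k + 1)) ^ 4 := Nat.pow_le_pow_left (by omega) 4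
    rw [mul_pow, mul_pow] at h1
    rw [pow_succ 3 k]
    omega

section Family

variable {p : ℕ} {A : Finset ℕ} {l : ℕ → ℕ}

theorem repunit_length_injOn (hA : ∀ r ∈ A, IsRepunit p r (l r)) : Set.InjOn l A := by
  intro r hr s hs h
  by_contra hne
  rcases Nat.lt_or_gt_of_ne hne with h' | h'
  · have := (hA s hs).strictMono_base (hA r hr) h'
    omega
  · have := (hA r hr).strictMono_base (hA s hs) h'
    omega

theorem prod_length_dvd (hp : p.Prime) (hA : ∀ r ∈ A, IsRepunit p r (l r)) :
    ∏ r ∈ A, l r ∣ p - 1 := by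
  rw [← prod_image (g := l) (f := fun x => x) (repunit_length_injOn hA)]
  refine prod_primes_dvd _ (fun a ha => ?_) (fun a ha => ?_) <;>
    obtain ⟨r, hr, rfl⟩ := mem_image.1 ha
  · exact (hA r hr).2.2.1.prime
  · exact (hA r hr).length_dvd hp

theorem coprime_prod_length {q : ℕ} (hq : q.Prime) (hA : ∀ r ∈ A, IsRepunit p r (l r))
    (h : ∀ r ∈ A, l r ≠ q) : Nat.Coprime (∏ r ∈ A, l r) q :=
  Nat.Coprime.prod_left fun r hr => (Nat.coprime_primes (hA r hr).2.2.1 hq).2 (h r hr)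

theorem two_mul_prod_length_dvd (hp : p.Prime) (hA : ∀ r ∈ A, IsRepunit p r (l r))
    {r : ℕ} (hr : r ∈ A) (hrl : ∀ t ∈ A, l t ≠ r) : (∏ t ∈ A, l t) * 2 * r ∣ p - 1 := by
  have h2 : (∏ t ∈ A, l t) * 2 ∣ p - 1 :=
    (coprime_prod_length Nat.prime_two hA fun t ht => (hA t ht).2.2.2.1).mul_dvd_of_dvd_of_dvd
      (prod_length_dvd hp hA) ((hA r hr).two_dvd hp)
  refine Nat.Coprime.mul_dvd_of_dvd_of_dvd (.mul_left ?_ ?_) h2 (hA r hr).base_dvd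
  · exact coprime_prod_length (hA r hr).1 hA hrl
  · exact (Nat.coprime_primes Nat.prime_two (hA r hr).1).2 (hA r hr).2.1.symm

theorem two_mul_prod_length_mul_dvd (hp : p.Prime) (hA : ∀ r ∈ A, IsRepunit p r (l r))
    {r s : ℕ} (hr : r ∈ A) (hs : s ∈ A) (hrs : r ≠ s) (hrl : ∀ t ∈ A, l t ≠ r)
    (hsl : ∀ t ∈ A, l t ≠ s) : (∏ t ∈ A, l t) * 2 * r * s ∣ p - 1 := by
  refine Nat.Coprime.mul_dvd_of_dvd_of_dvd (.mul_left (.mul_left ?_ ?_) ?_)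
    (two_mul_prod_length_dvd hp hA hr hrl) (hA s hs).base_dvd
  · exact coprime_prod_length (hA s hs).1 hA hsl
  · exact (Nat.coprime_primes Nat.prime_two (hA s hs).1).2 (hA s hs).2.1.symm
  · exact (Nat.coprime_primes (hA r hr).1 (hA s hs).1).2 hrs

theorem prod_length_pow_le {B : Finset ℕ} (hB : ∀ r ∈ B, IsRepunit p r (l r)) (hp : p.Prime)
    (h7 : ∀ r ∈ B, 7 ≤ r) : (∏ r ∈ B, l r) ^ 7 ≤ 4 ^ 7 * p ^ 5 := by
  rcases B.eq_empty_or_nonempty with rfl | hne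
  · have := Nat.one_le_pow 5 p hp.pos
    simp only [prod_empty, one_pow]
    omega
  obtain ⟨s, hs, hmax⟩ := exists_max_image B l hne
  have h1 : ∏ r ∈ B, l r ≤ 4 ^ l s := by
    refine le_trans ?_ (primorial_le_four_pow (l s))
    rw [← prod_image (g := l) (f := fun x => x) (repunit_length_injOn hB)]
    refine prod_le_prod_of_subset_of_one_le' (fun a ha => ?_) fun a ha _ => ?_
    · obtain ⟨r, hr, rfl⟩ := mem_image.1 ha
      simpa [Nat.lt_succ_iff] using ⟨hmax r hr, (hB r hr).2.2.1⟩
    · exact (mem_filter.1 ha).2.one_le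
  obtain ⟨u, hu⟩ : ∃ u, l s = u + 1 := ⟨l s - 1, by have := (hB s hs).three_le_length; omega⟩
  have h2 : 7 ^ u ≤ p := by
    have := (hB s hs).pow_lt
    rw [hu, Nat.add_sub_cancel] at this
    exact (Nat.pow_le_pow_left (h7 s hs) u).trans this.le
  calc (∏ r ∈ B, l r) ^ 7 ≤ (4 ^ (u + 1)) ^ 7 := Nat.pow_le_pow_left (hu ▸ h1) 7
    _ = 4 ^ 7 * (4 ^ 7) ^ u := by rw [← pow_mul, ← pow_mul, ← pow_add]; congr 1; ring
    _ ≤ 4 ^ 7 * (7 ^ 5) ^ u := Nat.mul_le_mul_left _ (Nat.pow_le_pow_left (by norm_num) u)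
    _ = 4 ^ 7 * (7 ^ u) ^ 5 := by rw [← pow_mul, ← pow_mul, mul_comm 5 u]
    _ ≤ 4 ^ 7 * p ^ 5 := by gcongr

theorem prod_length_le (hp : p.Prime) (hA : ∀ r ∈ A, IsRepunit p r (l r)) {n : ℕ} (hn0 : 0 < n)
    (hn : ∀ r ∈ A, l r ≤ n) : (∏ r ∈ A, l r) ^ 7 ≤ n ^ 14 * (4 ^ 7 * p ^ 5) := by
  rw [← prod_filter_mul_prod_filter_not A (fun r => r < 7), mul_pow]
  refine Nat.mul_le_mul ?_ (prod_length_pow_le (fun r hr => hA r (mem_filter.1 hr).1) hp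
    fun r hr => not_lt.1 (mem_filter.1 hr).2)
  rw [show n ^ 14 = (n ^ 2) ^ 7 by ring]
  refine Nat.pow_le_pow_left ?_ 7
  refine (prod_le_pow_card _ _ n fun r hr => hn r (mem_filter.1 hr).1).trans
    (Nat.pow_le_pow_right hn0 ?_)
  have : A.filter (· < 7) ⊆ {3, 5} := by
    intro r hr
    obtain ⟨hr, h7⟩ := mem_filter.1 hr
    have h1 := (hA r hr).1
    have h2 := (hA r hr).2.1
    interval_cases r <;> first | (simp; done) | exact absurd rfl h2 | exact absurd h1 (by norm_num)
  exact (card_le_card this).trans (by decide)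

theorem repunit_family_bound {p L n r₁ r₂ S : ℕ} (h75 : 75 ≤ n) (hpn : 3 ^ (n - 1) < p)
    (hSle : 2 * S ≤ r₂ * (r₂ - 1)) (hr₂n : r₂ ≤ n) (hr₁S : r₁ ≤ n * S)
    (hL : L ^ 7 ≤ n ^ 14 * (4 ^ 7 * p ^ 5)) : 2 * L * (r₁ - 1 + S) ≤ p := by
  by_contra! hpX
  have hS2 : 2 * S ≤ n * (n - 1) := hSle.trans (Nat.mul_le_mul hr₂n (by omega))
  have h1 : 2 * (r₁ - 1 + S) ≤ n ^ 3 := by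
    have : 2 * (r₁ - 1 + S) ≤ (n + 1) * (2 * S) := by
      have : r₁ - 1 ≤ n * S := by omega
      nlinarith
    refine this.trans ((Nat.mul_le_mul_left _ hS2).trans ?_)
    zify [show 1 ≤ n by omega]
    nlinarith
  have h2 : p ≤ L * n ^ 3 := by nlinarith
  have h4 : p ^ 5 * p ^ 2 ≤ p ^ 5 * (4 ^ 7 * n ^ 35) := calc
    p ^ 5 * p ^ 2 = p ^ 7 := by rw [← pow_add]
    _ ≤ (L * n ^ 3) ^ 7 := Nat.pow_le_pow_left h2 7
    _ = L ^ 7 * n ^ 21 := by rw [mul_pow, ← pow_mul]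
    _ ≤ n ^ 14 * (4 ^ 7 * p ^ 5) * n ^ 21 := Nat.mul_le_mul_right _ hL
    _ = p ^ 5 * (4 ^ 7 * n ^ 35) := by ring
  have h5 := Nat.le_of_mul_le_mul_left h4 (pow_pos ((Nat.zero_le _).trans_lt hpn) 5)
  have h7 : (3 ^ (n - 1)) ^ 2 < p ^ 2 := Nat.pow_lt_pow_left hpn (by norm_num)
  rw [← pow_mul, mul_comm, pow_mul] at h7
  exact absurd (h7.trans_le h5) (not_lt.2 (pow_bound h75))

/-- The weighted sum of `r - 1` over all representations of `p` as a repunit is small. -/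
theorem repunit_sum_lt (hp : p.Prime) (hA : ∀ r ∈ A, IsRepunit p r (l r)) (hne : A.Nonempty) :
    2 * (∏ r ∈ A, (l r : ℚ)) * ∑ r ∈ A, ((r : ℚ) - 1) * (1 - 1 / l r) <
      p + ∏ r ∈ A, (l r : ℚ) := by
  by_contra! hle
  set L : ℕ := ∏ r ∈ A, l r with hL
  have hLc : (L : ℚ) = ∏ r ∈ A, (l r : ℚ) := by push_cast [hL]; rfl
  rw [← hLc] at hle
  have hLpos : 0 < L := prod_pos fun r hr => (hA r hr).2.2.1.pos
  have hLq : (0 : ℚ) < L := by exact_mod_cast hLpos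
  have hp1 := hp.one_lt
  have term_le : ∀ r ∈ A, ((r : ℚ) - 1) * (1 - 1 / l r) ≤ ((r - 1 : ℕ) : ℚ) := by
    intro r hr
    have h3 := (hA r hr).three_le_base
    rw [Nat.cast_sub (by omega), Nat.cast_one]
    have : (3 : ℚ) ≤ r := by exact_mod_cast h3
    have : (0 : ℚ) ≤ 1 / l r := by positivity
    nlinarith
  set r₁ := A.max' hne with hr₁
  have hr₁A : r₁ ∈ A := A.max'_mem hne
  have h₁3 := (hA r₁ hr₁A).three_le_base
  rcases (A.erase r₁).eq_empty_or_nonempty with hemp | hne'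
  · have hAs : A = {r₁} := by
      rw [← insert_erase hr₁A, hemp]; simp
    have hb := (hA r₁ hr₁A).single_bound
    have hl3 := (hA r₁ hr₁A).three_le_length
    rw [hLc, hAs, prod_singleton, sum_singleton] at hle
    have hl0 : (l r₁ : ℚ) ≠ 0 := by positivity
    have hb' : 2 * (((l r₁ : ℚ) - 1) * ((r₁ : ℚ) - 1)) < p + l r₁ := by
      have : ((2 * ((l r₁ - 1) * (r₁ - 1)) : ℕ) : ℚ) < ((p + l r₁ : ℕ) : ℚ) := by
        exact_mod_cast hb
      push_cast [Nat.cast_sub (show 1 ≤ l r₁ by omega), Nat.cast_sub (show 1 ≤ r₁ by omega)] at this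
      exact this
    have e : 2 * (l r₁ : ℚ) * (((r₁ : ℚ) - 1) * (1 - 1 / l r₁)) =
        2 * (((l r₁ : ℚ) - 1) * ((r₁ : ℚ) - 1)) := by field_simp
    linarith
  set A' := A.erase r₁ with hA'
  set r₂ := A'.max' hne' with hr₂
  have hr₂A' : r₂ ∈ A' := A'.max'_mem hne'
  have hr₂A : r₂ ∈ A := mem_of_mem_erase hr₂A'
  have hlt : r₂ < r₁ := lt_of_le_of_ne (A.le_max' _ hr₂A) (ne_of_mem_erase hr₂A')
  have h₂3 := (hA r₂ hr₂A).three_le_base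
  set S : ℕ := ∑ r ∈ A', (r - 1) with hS
  have hSr₂ : r₂ - 1 ≤ S := single_le_sum (f := fun r => r - 1) (fun _ _ => Nat.zero_le _) hr₂A'
  have hSle : 2 * S ≤ r₂ * (r₂ - 1) := sum_pred_le fun r hr => A'.le_max' r hr
  have hXle : ∑ r ∈ A, ((r : ℚ) - 1) * (1 - 1 / l r) ≤ ((r₁ : ℚ) - 1) * (1 - 1 / l r₁) + S := by
    rw [← add_sum_erase A _ hr₁A, hS, Nat.cast_sum]
    gcongr with r hr
    exact term_le r (mem_of_mem_erase hr)
  have hpS : (p + L : ℚ) ≤ 2 * L * (((r₁ : ℚ) - 1) * (1 - 1 / l r₁) + S) :=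
    hle.trans (by gcongr)
  have hpX : p < 2 * L * (r₁ - 1 + S) := by
    have h1 := term_le r₁ hr₁A
    have : (p + L : ℚ) ≤ 2 * L * ((r₁ - 1 : ℕ) + S) := hpS.trans (by gcongr)
    have : p + L ≤ 2 * L * (r₁ - 1 + S) := by exact_mod_cast this
    omega
  obtain ⟨r₀, hr₀, hmax⟩ := exists_max_image A l hne
  set n := l r₀ with hn
  have hn3 := (hA r₀ hr₀).three_le_length
  have hpn : 3 ^ (n - 1) < p :=
    (Nat.pow_le_pow_left (hA r₀ hr₀).three_le_base _).trans_lt (hA r₀ hr₀).pow_lt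
  have hr₂n : r₂ ≤ n := by
    by_contra! hlt'
    have hd := two_mul_prod_length_mul_dvd hp hA hr₁A hr₂A hlt.ne'
      (fun t ht => by have := hmax t ht; omega) (fun t ht => by have := hmax t ht; omega)
    rw [← hL] at hd
    have hd := Nat.le_of_dvd (by omega) hd
    have h1 : r₁ - 1 + S ≤ r₁ * r₂ := by
      zify [show 1 ≤ r₁ by omega, show 1 ≤ r₂ by omega] at hSle ⊢
      nlinarith
    have h2 := Nat.mul_le_mul_left (2 * L) h1
    have h3 : L * 2 * r₁ * r₂ = 2 * L * (r₁ * r₂) := by ring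
    omega
  have hr₁S : r₁ ≤ n * S := by
    rcases le_or_gt r₁ n with h | h
    · exact h.trans (Nat.le_mul_of_pos_right n (by omega))
    have hd := two_mul_prod_length_dvd hp hA hr₁A (fun t ht => by have := hmax t ht; omega)
    rw [← hL] at hd
    have hd := Nat.le_of_dvd (by omega) hd
    have hd' : (L * 2 * r₁ : ℚ) ≤ p := by exact_mod_cast (by omega : L * 2 * r₁ ≤ p)
    have h1 : (r₁ : ℚ) < ((r₁ : ℚ) - 1) * (1 - 1 / l r₁) + S := by
      by_contra! hcon
      have := mul_le_mul_of_nonneg_left hcon (by positivity : (0 : ℚ) ≤ 2 * L)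
      linarith
    have hl0 : (0 : ℚ) < l r₁ := by exact_mod_cast (hA r₁ hr₁A).2.2.1.pos
    have hl1 : (l r₁ : ℚ) ≤ n := by exact_mod_cast hmax r₁ hr₁A
    have hl2 : 1 / (l r₁ : ℚ) ≤ 1 := by
      rw [div_le_one hl0]; exact_mod_cast (hA r₁ hr₁A).2.2.1.one_le
    have h2 : (r₁ : ℚ) / l r₁ < S := by
      have : (r₁ : ℚ) / l r₁ = r₁ * (1 / l r₁) := by ring
      nlinarith
    rw [div_lt_iff₀ hl0] at h2
    have h3 : (r₁ : ℚ) ≤ n * S := by nlinarith [(by positivity : (0 : ℚ) ≤ S)]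
    exact_mod_cast h3
  by_cases hsing : ∃ r₃ ∈ A', r₃ ≠ r₂
  · obtain ⟨r₃, hr₃, hne₃⟩ := hsing
    have hr₃A := mem_of_mem_erase hr₃
    have hr₃r₂ : r₃ ≤ r₂ := A'.le_max' _ hr₃
    rcases lt_or_ge n 75 with h75 | h75
    · refine hne₃ ((hA r₃ hr₃A).base_eq_of_lt (hA r₂ hr₂A) ?_ ?_ ?_ ?_)
      · omega
      · omega
      · have := hmax r₃ hr₃A; omega
      · have := hmax r₂ hr₂A; omega
    · exact lt_irrefl _ (hpX.trans_le (repunit_family_bound h75 hpn hSle hr₂n hr₁S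
        (prod_length_le hp hA (by omega) hmax)))
  · push Not at hsing
    have hA's : A' = {r₂} := eq_singleton_iff_unique_mem.2 ⟨hr₂A', hsing⟩
    have hS1 : S = r₂ - 1 := by rw [hS, hA's, sum_singleton]
    have hL2 : L ≤ n ^ 2 := by
      rw [hL, ← mul_prod_erase A _ hr₁A, ← hA', hA's, prod_singleton, sq]
      exact Nat.mul_le_mul (hmax _ hr₁A) (hmax _ hr₂A)
    have hr₁n : r₁ ≤ n * (n - 1) := hr₁S.trans (Nat.mul_le_mul_left n (by omega))
    have h1 : r₁ - 1 + S ≤ n ^ 2 := by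
      have : r₁ - 1 + S ≤ n * (n - 1) + n := by omega
      refine this.trans ?_
      zify [show 1 ≤ n by omega]
      nlinarith
    have h2 : p < 2 * n ^ 4 := calc
      p < 2 * L * (r₁ - 1 + S) := hpX
      _ ≤ 2 * n ^ 2 * n ^ 2 := by gcongr
      _ = 2 * n ^ 4 := by ring
    have hn11 : n < 11 := by
      by_contra! h
      have := pow_bound' h
      omega
    have hnp : n.Prime := (hA r₀ hr₀).2.2.1
    have hn7 : n ≤ 7 := by
      clear_value n
      by_contra! h
      interval_cases n <;> revert hnp <;> decide
    have h3 : n * (n - 1) ≤ 7 * 6 := Nat.mul_le_mul hn7 (by omega)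
    refine hlt.ne ((hA r₂ hr₂A).base_eq_of_lt (hA r₁ hr₁A) ?_ ?_ ?_ ?_)
    · omega
    · omega
    · have := hmax r₂ hr₂A; omega
    · have := hmax r₁ hr₁A; omega

end Family

theorem geom_sum_mul_exponent (r u v : ℕ) :
    ∑ i ∈ range (u * v), r ^ i = (∑ i ∈ range u, (r ^ v) ^ i) * ∑ i ∈ range v, r ^ i := by
  induction u with
  | zero => simp
  | succ u ih =>
    rw [Nat.succ_mul, sum_range_add, ih, sum_range_succ, add_mul]
    simp only [pow_add, ← pow_mul, mul_comm v u, ← mul_sum]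

theorem lt_geom_sum {x u : ℕ} (hx : 2 ≤ x) (hu : 2 ≤ u) : u < ∑ i ∈ range u, x ^ i := by
  calc u = ∑ i ∈ range u, 1 := by simp
    _ < ∑ i ∈ range u, x ^ i :=
      sum_lt_sum (fun i _ => Nat.one_le_pow i x (by omega))
        ⟨1, by simpa using (by omega : 1 < u),
        by simpa using (by omega : 1 < x)⟩

theorem prime_length_of_prime_geom_sum {r l : ℕ} (hr : 2 ≤ r) (hl : 2 ≤ l)
    (h : (∑ i ∈ range l, r ^ i).Prime) : l.Prime := by
  by_contra hcon
  obtain ⟨u, ⟨v, rfl⟩, hu, huv⟩ := (Nat.not_prime_iff_exists_dvd_lt hl).1 hcon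
  have hv : 2 ≤ v := by
    by_contra! h'
    interval_cases v <;> omega
  rw [geom_sum_mul_exponent] at h
  have h1 := lt_geom_sum (hr.trans (Nat.le_self_pow (n := v) (by omega) r)) hu
  have h2 := lt_geom_sum hr hv
  exact Nat.not_prime_mul (by omega) (by omega) h

theorem not_dvd_length_of_geom_sum_eq_pow {p r l c : ℕ} (hp : p.Prime) (hp2 : p ≠ 2) (hr : 2 ≤ r)
    (hl : l ≠ 0) (h : ∑ i ∈ range l, r ^ i = p ^ c) : ¬ p ∣ l := by
  rintro ⟨k, rfl⟩
  have : Fact p.Prime := ⟨hp⟩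
  have hk : k ≠ 0 := by rintro rfl; simp at hl
  rw [geom_sum_mul_exponent] at h
  set x := r ^ k with hx
  have hx2 : 2 ≤ x := hr.trans (Nat.le_self_pow hk r)
  have hlt := lt_geom_sum hx2 hp.two_le
  set F := ∑ i ∈ range p, x ^ i with hF
  obtain ⟨b, -, hb⟩ := (Nat.dvd_prime_pow hp).1 (h ▸ dvd_mul_right F _)
  have hb2 : 2 ≤ b := by
    by_contra! hb'
    have : p ^ b ≤ p ^ 1 := Nat.pow_le_pow_right hp.pos (by omega)
    rw [pow_one] at this
    omega
  have hdvd : p ^ 2 ∣ F := hb ▸ pow_dvd_pow p hb2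
  have hx1 : (x : ZMod p) = 1 := by
    have e := geom_sum_mul (x : ZMod p) p
    have : ((F : ℕ) : ZMod p) = 0 :=
      (ZMod.natCast_eq_zero_iff _ _).2 ((dvd_pow_self p two_ne_zero).trans hdvd)
    rw [hF] at this
    push_cast at this
    rw [this, zero_mul, ZMod.pow_card] at e
    exact (sub_eq_zero.1 e.symm)
  obtain ⟨t, ht⟩ : (p : ℤ) ∣ x - 1 := by
    rw [← ZMod.intCast_zmod_eq_zero_iff_dvd]
    push_cast
    rw [hx1, sub_self]
  have key := odd_sq_dvd_geom_sum₂_sub (a := (1 : ℤ)) t (hp.odd_of_ne_two hp2)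
  rw [show (1 : ℤ) + p * t = x by linarith] at key
  simp only [one_pow, mul_one] at key
  have hF' : ((p : ℤ)) ^ 2 ∣ ∑ i ∈ range p, (x : ℤ) ^ i := by exact_mod_cast hdvd
  have h3 : (p : ℤ) ^ 2 ∣ p := (dvd_sub_right hF').1 key
  have h4 : p ^ 2 ≤ p := Nat.le_of_dvd hp.pos (by exact_mod_cast h3)
  nlinarith [hp.two_le]

section SquareZero

variable {R : Type*} [CommRing R] {ε : R}

theorem one_add_mul_pow_of_sq_eq_zero (hε : ε * ε = 0) (a : R) (k : ℕ) :
    (1 + ε * a) ^ k = 1 + ε * (k * a) := by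
  induction k with
  | zero => simp
  | succ k ih =>
    rw [pow_succ, ih]
    push_cast
    linear_combination (k * a * a) * hε

theorem prod_one_add_mul_of_sq_eq_zero {ι : Type*} (hε : ε * ε = 0) (s : Finset ι) (f : ι → R) :
    ∏ i ∈ s, (1 + ε * f i) = 1 + ε * ∑ i ∈ s, f i := by
  classical
  induction s using Finset.induction_on with
  | empty => simp
  | insert i s hi ih =>
    rw [prod_insert hi, sum_insert hi, ih]
    linear_combination (f i * ∑ i ∈ s, f i) * hε

theorem two_add_pow_of_sq_eq_zero (hε : ε * ε = 0) (k : ℕ) :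
    (2 + ε) ^ (k + 1) = 2 ^ (k + 1) + (k + 1 : ℕ) * 2 ^ k * ε := by
  induction k with
  | zero => simp
  | succ k ih =>
    rw [pow_succ, ih]
    push_cast
    linear_combination ((k + 1) * 2 ^ k) * hε

end SquareZero

/-- Raising `2 m²` to the power `∏ l r` and expanding to first order in `p`. -/
theorem dvd_two_mul_sum_sub_prod {p m a : ℕ} {A : Finset ℕ} {l c : ℕ → ℕ} (hp : p.Prime)
    (hp2 : p ≠ 2) (ha : 1 ≤ a) (hl : ∀ r ∈ A, l r ≠ 0) (hc : ∀ r ∈ A, 1 ≤ c r)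
    (hg : ∀ r ∈ A, ∑ i ∈ range (l r), r ^ i = p ^ c r)
    (hm : ∏ r ∈ A, r ^ (l r - 1) = m) (h : ∑ k ∈ range (2 * a + 1), p ^ k + 1 = 2 * m) :
    (p : ℤ) ∣ 2 * ∑ r ∈ A, (((l r - 1) * ∏ t ∈ A.erase r, l t : ℕ) : ℤ) *
      ((r - 1) * p ^ (c r - 1)) - ∏ r ∈ A, (l r : ℤ) := by
  set k : ℕ → ℕ := fun r => (l r - 1) * ∏ t ∈ A.erase r, l t with hk
  set L := ∏ r ∈ A, l r with hL
  have hLpos : 0 < L := prod_pos fun r hr => Nat.pos_of_ne_zero (hl r hr)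
  obtain ⟨L', hL'⟩ : ∃ L', L = L' + 1 := ⟨L - 1, by omega⟩
  have hε : (p : ZMod (p ^ 2)) * p = 0 := by
    rw [← Nat.cast_mul, ← sq, ZMod.natCast_self]
  have hpow : ∀ r ∈ A, ((r : ZMod (p ^ 2)) ^ (l r)) = 1 + p * ((r - 1) * p ^ (c r - 1)) := by
    intro r hrA
    have e := geom_sum_mul (r : ZMod (p ^ 2)) (l r)
    have e' := congrArg (Nat.cast : ℕ → ZMod (p ^ 2)) (hg r hrA)
    push_cast at e'
    obtain ⟨d, hd⟩ : ∃ d, c r = d + 1 := ⟨c r - 1, by have := hc r hrA; omega⟩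
    rw [e', hd] at e
    rw [hd, Nat.add_sub_cancel]
    linear_combination -e
  have hmL : (m : ZMod (p ^ 2)) ^ L =
      1 + p * ∑ r ∈ A, (k r : ZMod (p ^ 2)) * ((r - 1) * p ^ (c r - 1)) := by
    rw [← prod_one_add_mul_of_sq_eq_zero hε, ← hm]
    push_cast
    rw [← prod_pow]
    refine prod_congr rfl fun r hrA => ?_
    rw [← one_add_mul_pow_of_sq_eq_zero hε, ← hpow r hrA, ← pow_mul, ← pow_mul, hL,
      ← mul_prod_erase A l hrA, hk]
    congr 1
    ring
  have h2m : (2 * m : ZMod (p ^ 2)) = 2 + p := by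
    have e := congrArg (Nat.cast : ℕ → ZMod (p ^ 2)) h
    obtain ⟨b, hb⟩ : ∃ b, 2 * a + 1 = b + 2 := ⟨2 * a - 1, by omega⟩
    rw [hb, sum_range_succ', sum_range_succ'] at e
    push_cast at e
    have : ∑ k ∈ range b, (p : ZMod (p ^ 2)) ^ (k + 1 + 1) = 0 :=
      sum_eq_zero fun i _ => by linear_combination (p : ZMod (p ^ 2)) ^ i * hε
    rw [this] at e
    linear_combination -e
  have key := congrArg (· ^ L) h2m
  simp only [mul_pow, hmL] at key
  rw [hL', two_add_pow_of_sq_eq_zero hε] at key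
  have key' : (((p * (2 ^ L' * (2 * ∑ r ∈ A, (k r : ℤ) * ((r - 1) * p ^ (c r - 1)) - L)) : ℤ)) :
      ZMod (p ^ 2)) = 0 := by
    push_cast
    rw [hL']
    push_cast at key ⊢
    linear_combination key
  rw [ZMod.intCast_zmod_eq_zero_iff_dvd] at key'
  push_cast at key'
  rw [sq] at key'
  have hp0 : (p : ℤ) ≠ 0 := by exact_mod_cast hp.ne_zero
  have h3 := (mul_dvd_mul_iff_left hp0).1 key'
  have hcop : IsCoprime (p : ℤ) (2 ^ L') := by
    refine IsCoprime.pow_right ?_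
    exact_mod_cast Nat.isCoprime_iff_coprime.2 ((Nat.coprime_primes hp Nat.prime_two).2 hp2)
  have h4 := hcop.dvd_of_dvd_mul_left h3
  rw [hL] at h4
  push_cast at h4
  simpa [hk] using h4

/-- For `m` odd and `p` an odd prime, `σ (m ^ 2) = p ^ (2 * a)` and `σ (p ^ (2 * a)) + 1 = 2 * m ^ 2`
cannot hold together. -/
theorem sigma_sq_ne_prime_pow {p m a : ℕ} (hp : p.Prime) (hp2 : p ≠ 2) (hm : Odd m) (ha : 1 ≤ a)
    (hσ : ArithmeticFunction.sigma 1 (m ^ 2) = p ^ (2 * a)) :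
    ∑ k ∈ range (2 * a + 1), p ^ k + 1 ≠ 2 * m ^ 2 := by
  intro h
  have hm0 : m ≠ 0 := by rintro rfl; simp at hm
  have hsupp : (m ^ 2).factorization.support = m.primeFactors := by
    rw [Nat.support_factorization, Nat.primeFactors_pow m two_ne_zero]
  set l : ℕ → ℕ := fun r => (m ^ 2).factorization r + 1 with hl
  have hl' : ∀ r, l r = 2 * m.factorization r + 1 := fun r => by simp [hl]
  have hprime : ∀ r ∈ m.primeFactors, r.Prime := fun r hr => Nat.prime_of_mem_primeFactors hr
  have hr2 : ∀ r ∈ m.primeFactors, r ≠ 2 := by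
    rintro r hr rfl
    exact Nat.not_even_iff_odd.2 hm (even_iff_two_dvd.2 (Nat.dvd_of_mem_primeFactors hr))
  have hl3 : ∀ r ∈ m.primeFactors, 3 ≤ l r := fun r hr => by
    have := (hprime r hr).factorization_pos_of_dvd hm0 (Nat.dvd_of_mem_primeFactors hr)
    have := hl' r
    omega
  have hprod : ∏ r ∈ m.primeFactors, ∑ i ∈ range (l r), r ^ i = p ^ (2 * a) := by
    rw [← hσ, ArithmeticFunction.isMultiplicative_sigma.multiplicative_factorization _
      (pow_ne_zero 2 hm0), Finsupp.prod, hsupp]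
    exact prod_congr rfl fun r hr =>
      (ArithmeticFunction.sigma_one_apply_prime_pow (hprime r hr)).symm
  have hex : ∀ r, ∃ c, r ∈ m.primeFactors → ∑ i ∈ range (l r), r ^ i = p ^ c := fun r => by
    by_cases hr : r ∈ m.primeFactors
    · obtain ⟨c, -, hc⟩ := (Nat.dvd_prime_pow hp).1 (hprod ▸ dvd_prod_of_mem _ hr)
      exact ⟨c, fun _ => hc⟩
    · exact ⟨0, fun h => absurd h hr⟩
  choose c hc using hex
  have hc1 : ∀ r ∈ m.primeFactors, 1 ≤ c r := fun r hr => by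
    by_contra! h0
    have h1 := hc r hr
    rw [show c r = 0 by omega, pow_zero] at h1
    have h2 := lt_geom_sum (hprime r hr).two_le (u := l r) (by have := hl3 r hr; omega)
    have := hl3 r hr
    omega
  have hmp : ∏ r ∈ m.primeFactors, r ^ (l r - 1) = m ^ 2 := by
    conv_rhs => rw [← Nat.prod_factorization_pow_eq_self (pow_ne_zero 2 hm0), Finsupp.prod, hsupp]
    simp [hl]
  have hdvd := dvd_two_mul_sum_sub_prod hp hp2 ha (fun r hr => by have := hl3 r hr; omega)
    hc1 hc hmp h
  have hpl : ∀ r ∈ m.primeFactors, ¬ p ∣ l r := fun r hr =>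
    not_dvd_length_of_geom_sum_eq_pow hp hp2 (hprime r hr).two_le
      (by have := hl3 r hr; omega) (hc r hr)
  set T := m.primeFactors.filter (fun r => c r = 1) with hT
  set U := m.primeFactors.filter (fun r => ¬ c r = 1) with hU
  have hTU : (∏ r ∈ T, l r) * ∏ r ∈ U, l r = ∏ r ∈ m.primeFactors, l r :=
    prod_filter_mul_prod_filter_not _ _ _
  set V : ℤ := 2 * ∑ r ∈ T, ((r : ℤ) - 1) * (((l r - 1) * ∏ t ∈ T.erase r, l t : ℕ) : ℤ) -
    ((∏ r ∈ T, l r : ℕ) : ℤ) with hV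
  have hVp : (p : ℤ) ∣ V := by
    have hVU : (p : ℤ) ∣ ((∏ r ∈ U, l r : ℕ) : ℤ) * V := by
      rw [← sum_filter_add_sum_filter_not _ (fun r => c r = 1)] at hdvd
      rw [← hT, ← hU, mul_add, add_sub_right_comm] at hdvd
      have hUs : (p : ℤ) ∣ 2 * ∑ r ∈ U, (((l r - 1) * ∏ t ∈ m.primeFactors.erase r, l t : ℕ) : ℤ) *
          ((r - 1) * p ^ (c r - 1)) := by
        refine Dvd.dvd.mul_left (dvd_sum fun r hr => ?_) _
        obtain ⟨hrm, hr1⟩ := mem_filter.1 hr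
        have := hc1 r hrm
        exact Dvd.dvd.mul_left (Dvd.dvd.mul_left (dvd_pow_self _ (by omega)) _) _
      have h1 := (dvd_add_left hUs).1 hdvd
      suffices heq : ((∏ r ∈ U, l r : ℕ) : ℤ) * V = 2 * ∑ r ∈ T,
          (((l r - 1) * ∏ t ∈ m.primeFactors.erase r, l t : ℕ) : ℤ) *
          ((r - 1) * p ^ (c r - 1)) - ∏ r ∈ m.primeFactors, (l r : ℤ) from heq ▸ h1
      rw [hV, mul_sub, mul_left_comm, mul_sum, ← Nat.cast_mul, mul_comm (∏ r ∈ U, l r), hTU]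
      refine congrArg₂ (· - ·) (congrArg _ (sum_congr rfl fun r hr => ?_)) (Nat.cast_prod _ _)
      obtain ⟨hrm, hr1⟩ := mem_filter.1 hr
      have hsplit : ∏ t ∈ m.primeFactors.erase r, l t = (∏ t ∈ T.erase r, l t) * ∏ t ∈ U, l t := by
        have hlr : 0 < l r := Nat.succ_pos _
        refine Nat.eq_of_mul_eq_mul_left hlr ?_
        rw [← mul_assoc, mul_prod_erase _ _ hrm, mul_prod_erase _ _ hr, hTU]
      rw [hsplit, hr1]
      push_cast
      ring
    have hcop : IsCoprime (p : ℤ) ((∏ r ∈ U, l r : ℕ) : ℤ) := by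
      refine Nat.isCoprime_iff_coprime.2 (Nat.Coprime.prod_right fun r hr => ?_)
      exact (Nat.Prime.coprime_iff_not_dvd hp).2 (hpl r (mem_filter.1 hr).1)
    exact hcop.dvd_of_dvd_mul_left hVU
  have hrep : ∀ r ∈ T, IsRepunit p r (l r) := fun r hr => by
    obtain ⟨hrm, hr1⟩ := mem_filter.1 hr
    have h1 := hc r hrm
    rw [hr1, pow_one] at h1
    have h3 := hl3 r hrm
    have h2 := hl' r
    exact ⟨hprime r hrm, hr2 r hrm, prime_length_of_prime_geom_sum (hprime r hrm).two_le (by omega)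
      (h1 ▸ hp), by omega, h1.symm⟩
  have hodd : Odd (∏ r ∈ T, l r) := by
    refine Finset.prod_induction _ _ (fun _ _ => Odd.mul) odd_one fun r _ => ?_
    rw [hl' r]
    exact odd_two_mul_add_one _
  have hLlt : ∏ r ∈ T, l r < p := by
    have := Nat.le_of_dvd (by have := hp.two_le; omega) (prod_length_dvd hp hrep)
    have := hp.two_le
    omega
  have hVlb : -(p : ℤ) < V := by
    have : 0 ≤ ∑ r ∈ T, ((r : ℤ) - 1) * (((l r - 1) * ∏ t ∈ T.erase r, l t : ℕ) : ℤ) := by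
      refine sum_nonneg fun r hr => mul_nonneg ?_ (Int.natCast_nonneg _)
      have := (hrep r hr).three_le_base
      omega
    omega
  have hVub : V < p := by
    rcases T.eq_empty_or_nonempty with hT0 | hT0
    · rw [hV, hT0]
      simp only [sum_empty, prod_empty]
      omega
    · have hlt := repunit_sum_lt hp hrep hT0
      have e : 2 * (∏ r ∈ T, (l r : ℚ)) * ∑ r ∈ T, ((r : ℚ) - 1) * (1 - 1 / l r) =
          (V + (∏ r ∈ T, l r : ℕ) : ℤ) := by
        rw [hV, sub_add_cancel]
        push_cast
        rw [mul_assoc, mul_sum]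
        congr 1
        refine sum_congr rfl fun r hr => ?_
        have h3 := (hrep r hr).three_le_length
        have h0 : (l r : ℚ) ≠ 0 := by positivity
        rw [← mul_prod_erase T _ hr, Nat.cast_sub (by omega)]
        push_cast
        field_simp
      rw [e] at hlt
      have : (V + (∏ r ∈ T, l r : ℕ) : ℤ) < (p : ℤ) + (∏ r ∈ T, l r : ℕ) := by
        exact_mod_cast hlt
      omega
  have hV0 : V = 0 := Int.eq_zero_of_abs_lt_dvd hVp (abs_lt.2 ⟨hVlb, hVub⟩)
  obtain ⟨w, hw⟩ := hodd
  omega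

theorem eq_one_of_four_mul_sq_eq_three_pow_add_one {m k : ℕ} (h : 4 * m ^ 2 = 3 ^ k + 1) : m = 1 := by
  obtain ⟨u, rfl⟩ : ∃ u, m = u + 1 := ⟨m - 1, by
    have : m ≠ 0 := by rintro rfl; simp at h
    omega⟩
  have e : (2 * u + 1) * (2 * u + 3) = 3 ^ k := by nlinarith
  obtain ⟨x, -, hx⟩ := (Nat.dvd_prime_pow Nat.prime_three).1 (Dvd.intro _ e)
  obtain ⟨y, -, hy⟩ := (Nat.dvd_prime_pow Nat.prime_three).1 (Dvd.intro_left _ e)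
  rcases x with _ | x
  · simp at hx
    omega
  rcases y with _ | y
  · simp at hy
  · rw [pow_succ] at hx hy
    omega

theorem pred_mul_geom_sum_lt {p k : ℕ} (hp : 3 ≤ p) :
    (p - 1) * ∑ i ∈ range (k + 1), p ^ i < p * p ^ k := by
  have h1 : (p - 1) * ∑ i ∈ range (k + 1), p ^ i + 1 = p * p ^ k := by
    rw [← pow_succ']
    zify [show 1 ≤ p by omega]
    rw [mul_comm, geom_sum_mul]
    ring
  omega

theorem cofactor_of_sq_lt {p d e j : ℕ} (hp : p.Prime) (hp2 : p ≠ 2) (hd : Odd d) (hd3 : 3 ≤ d)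
    (he : 1 ≤ e) (hmain : (p - 1) * (d ^ 2 * e) < 2 * p * p ^ j)
    (hdvd : p ^ j ∣ d + ∑ i ∈ range j, p ^ i) : p = 3 ∧ j = 2 ∧ d = 5 ∧ e = 1 := by
  have hp3 := hp.three_le hp2
  have hG : (p - 1) * ∑ i ∈ range j, p ^ i + 1 = p ^ j := by
    zify [show 1 ≤ p by omega]
    rw [mul_comm, geom_sum_mul]
    ring
  have hle := Nat.le_of_dvd (by omega) hdvd
  obtain ⟨t, rfl⟩ : ∃ t, p = t + 3 := ⟨p - 3, by omega⟩
  simp only [show t + 3 - 1 = t + 2 by omega] at *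
  have hdJ : (t + 1) * (t + 3) ^ j + 1 ≤ (t + 2) * d := by nlinarith
  have hJ : (t + 1) ^ 2 * (t + 3) ^ j + 2 * (t + 1) < 2 * (t + 3) * (t + 2) := by
    have hJ0 := pow_pos hp.pos j
    refine Nat.lt_of_mul_lt_mul_left (a := (t + 3) ^ j) ?_
    have h1 := Nat.pow_le_pow_left hdJ 2
    have h2 : (t + 2) * d ^ 2 < 2 * (t + 3) * (t + 3) ^ j :=
      (Nat.mul_le_mul_left _ (Nat.le_mul_of_pos_right _ he)).trans_lt hmain
    have h3 := Nat.mul_lt_mul_of_pos_left h2 (show 0 < t + 2 by omega)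
    nlinarith
  have hj0 : j ≠ 0 := by
    rintro rfl
    have h1 : 3 ^ 2 * 1 ≤ d ^ 2 * e := Nat.mul_le_mul (Nat.pow_le_pow_left hd3 2) he
    have h2 := Nat.mul_le_mul_left (t + 2) h1
    rw [pow_zero] at hmain
    omega
  have hJp : t + 3 ≤ (t + 3) ^ j := Nat.le_self_pow hj0 _
  have ht : t < 2 := by
    by_contra! ht
    have := Nat.mul_le_mul_left ((t + 1) ^ 2) hJp
    nlinarith
  obtain rfl : t = 0 := by
    by_contra h
    obtain rfl : t = 1 := by omega
    exact absurd hp (by norm_num)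
  simp only [zero_add] at *
  have hj3 : j < 3 := by
    by_contra! h
    have : 3 ^ 3 ≤ 3 ^ j := Nat.pow_le_pow_right (by norm_num) h
    omega
  obtain ⟨w, rfl⟩ := hd
  obtain rfl | rfl : j = 1 ∨ j = 2 := by omega
  · simp at hdvd hmain
    have h1 : 5 ^ 2 * 1 ≤ (2 * w + 1) ^ 2 * e :=
      Nat.mul_le_mul (Nat.pow_le_pow_left (by omega) 2) he
    omega
  · simp [sum_range_succ] at hdvd hmain
    have hw : w < 3 := by
      by_contra! h
      have h1 : 7 ^ 2 * 1 ≤ (2 * w + 1) ^ 2 * e :=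
        Nat.mul_le_mul (Nat.pow_le_pow_left (by omega) 2) he
      omega
    obtain rfl : w = 2 := by omega
    refine ⟨trivial, rfl, rfl, by omega⟩

theorem geom_sum_cofactor_eq_one {p a m q d s : ℕ} (hp : p.Prime) (hp2 : p ≠ 2)
    (hd : Odd d) (hS : ∑ i ∈ range (2 * a + 1), p ^ i = d * q)
    (hE : (q + 1) * d * s = 2 * (p ^ a * m) ^ 2) (hds : d * s < 2 * q) (hs : s ≠ 0) : d = 1 := by
  have hp3 := hp.three_le hp2
  have hpd : Nat.Coprime p d := by
    refine (Nat.Prime.coprime_iff_not_dvd hp).2 fun h => ?_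
    have h1 : p ∣ ∑ i ∈ range (2 * a + 1), p ^ i := hS ▸ h.mul_right q
    rw [sum_range_succ'] at h1
    have h2 := (Nat.dvd_add_right (dvd_sum fun i _ => dvd_pow_self p (Nat.succ_ne_zero i))).1 h1
    exact hp.one_lt.ne' (Nat.dvd_one.1 (by simpa using h2))
  have hSlt := pred_mul_geom_sum_lt (k := 2 * a) hp3
  rw [hS] at hSlt
  by_contra hd1
  have hd3 : 3 ≤ d := by
    obtain ⟨w, rfl⟩ := hd
    omega
  obtain ⟨j, g, hpg, hg⟩ := Nat.exists_eq_pow_mul_and_not_dvd (n := q + 1) (by omega) p hp.ne_one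
  have hj : j < 2 * a := by
    refine (Nat.pow_lt_pow_iff_right hp.one_lt).1 ?_
    have h1 : p ^ j ≤ q + 1 := Nat.le_of_dvd (by omega) (hg ▸ dvd_mul_right _ _)
    have h2 : 2 * (d * q) < 3 * p ^ (2 * a) := by
      obtain ⟨t, rfl⟩ : ∃ t, p = t + 3 := ⟨p - 3, by omega⟩
      simp only [show t + 3 - 1 = t + 2 by omega] at hSlt
      nlinarith [Nat.zero_le (t * (t + 3) ^ (2 * a))]
    have h3 : 3 * q ≤ d * q := Nat.mul_le_mul_right q hd3
    omega
  obtain ⟨b, hb⟩ : ∃ b, 2 * a = j + b := ⟨2 * a - j, by omega⟩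
  have hgd : g * d * s = p ^ b * (2 * m ^ 2) := by
    refine Nat.eq_of_mul_eq_mul_left (pow_pos hp.pos j) ?_
    calc p ^ j * (g * d * s) = (p ^ j * g) * d * s := by ring
      _ = 2 * (p ^ a * m) ^ 2 := by rw [← hg, hE]
      _ = p ^ (2 * a) * (2 * m ^ 2) := by ring
      _ = p ^ j * (p ^ b * (2 * m ^ 2)) := by rw [hb, pow_add, mul_assoc]
  have hcop : Nat.Coprime (p ^ b) (g * d) :=
    Nat.Coprime.pow_left b (Nat.Coprime.mul_right ((Nat.Prime.coprime_iff_not_dvd hp).2 hpg) hpd)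
  obtain ⟨e, rfl⟩ := hcop.dvd_of_dvd_mul_left (Dvd.intro _ hgd.symm)
  have he : 1 ≤ e := Nat.pos_of_ne_zero fun h => hs (by simp [h])
  have hB := pow_pos hp.pos b
  have hmain : (p - 1) * (d ^ 2 * e) < 2 * p * p ^ j := by
    refine Nat.lt_of_mul_lt_mul_left (a := p ^ b) ?_
    have h1 : d * (d * (p ^ b * e)) < d * (2 * q) := Nat.mul_lt_mul_of_pos_left hds (by omega)
    have h2 := Nat.mul_lt_mul_of_pos_left h1 (show 0 < p - 1 by omega)
    calc p ^ b * ((p - 1) * (d ^ 2 * e)) = (p - 1) * (d * (d * (p ^ b * e))) := by ring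
      _ < (p - 1) * (d * (2 * q)) := h2
      _ = 2 * ((p - 1) * (d * q)) := by ring
      _ ≤ 2 * (p * p ^ (2 * a)) := Nat.mul_le_mul_left 2 hSlt.le
      _ = p ^ b * (2 * p * p ^ j) := by rw [hb, pow_add]; ring
  have hdvd : p ^ j ∣ d + ∑ i ∈ range j, p ^ i := by
    have h1 : p ^ j ∣ d + ∑ i ∈ range (2 * a + 1), p ^ i := by
      rw [hS]
      exact ⟨g * d, by linear_combination d * hg⟩
    rw [hb, add_assoc, sum_range_add, ← add_assoc] at h1
    refine (Nat.dvd_add_left (dvd_sum fun i _ => ?_)).1 h1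
    rw [pow_add]
    exact dvd_mul_right _ _
  obtain ⟨rfl, rfl, rfl, rfl⟩ := cofactor_of_sq_lt hp hp2 hd hd3 he hmain hdvd
  have h1 : g * 5 = 2 * m ^ 2 := by
    refine Nat.eq_of_mul_eq_mul_left hB ?_
    linarith
  obtain ⟨c, rfl⟩ : ∃ c, b = 2 * c := ⟨a - 1, by omega⟩
  have h2 := geom_sum_mul (3 : ℤ) (2 * a + 1)
  have h3 := congrArg (Nat.cast : ℕ → ℤ) hS
  push_cast at h3
  rw [h3, hb] at h2
  have h4 : 4 * m ^ 2 = 3 ^ (2 * c + 1) + 1 := by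
    zify at hg h1 ⊢
    have : (3 : ℤ) ^ (2 + 2 * c + 1) = 9 * 3 ^ (2 * c + 1) := by ring
    rw [this] at h2
    linarith
  obtain rfl := eq_one_of_four_mul_sq_eq_three_pow_add_one h4
  omega

/-- In an odd perfect number `q * n ^ 2` with Euler prime `q` of exponent one, `q < n`. -/
theorem not_lt_of_perfect {q n : ℕ} (hq : q.Prime) (hq4 : q % 4 = 1) (hn : Odd n)
    (hgcd : q.Coprime n) (hperf : ArithmeticFunction.sigma 1 (q * n ^ 2) = 2 * (q * n ^ 2)) :
    ¬ n < q := by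
  intro hnq
  have hn0 : n ≠ 0 := by rintro rfl; simp at hn
  have hσq : ArithmeticFunction.sigma 1 q = q + 1 := by
    have := ArithmeticFunction.sigma_one_apply_prime_pow (i := 1) hq
    simpa [sum_range_succ, add_comm] using this
  have hmul := ArithmeticFunction.isMultiplicative_sigma (k := 1)
  rw [hmul.map_mul_of_coprime (hgcd.pow_right 2), hσq] at hperf
  have hqσ : q ∣ ArithmeticFunction.sigma 1 (n ^ 2) := by
    refine Nat.Coprime.dvd_of_dvd_mul_left (m := q + 1) (by rw [Nat.coprime_self_add_right]; exact Nat.coprime_one_right q) ?_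
    rw [hperf]
    exact ⟨2 * n ^ 2, by ring⟩
  rw [hmul.multiplicative_factorization _ (pow_ne_zero 2 hn0), Finsupp.prod,
    hq.prime.dvd_finsetProd_iff] at hqσ
  obtain ⟨p, hpn, hqp⟩ := hqσ
  rw [Nat.support_factorization, Nat.primeFactors_pow n two_ne_zero] at hpn
  have hp := Nat.prime_of_mem_primeFactors hpn
  have hpdvd := Nat.dvd_of_mem_primeFactors hpn
  have hp2 : p ≠ 2 := by
    rintro rfl
    exact Nat.not_even_iff_odd.2 hn (even_iff_two_dvd.2 hpdvd)
  have hap := hp.factorization_pos_of_dvd hn0 hpdvd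
  have hfac := Nat.ordProj_mul_ordCompl_eq_self n p
  have hcop := Nat.coprime_ordCompl hp hn0
  rw [Nat.factorization_pow, Finsupp.smul_apply, smul_eq_mul,
    ArithmeticFunction.sigma_one_apply_prime_pow hp] at hqp
  set a := n.factorization p
  set m := n / p ^ a
  have hm : Odd m := by
    rw [← hfac] at hn
    exact (Nat.odd_mul.1 hn).2
  obtain ⟨d, hd⟩ := hqp
  rw [mul_comm q d] at hd
  set s := ArithmeticFunction.sigma 1 (m ^ 2)
  have hσn : ArithmeticFunction.sigma 1 (n ^ 2) = d * q * s := by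
    rw [← hfac, mul_pow, hmul.map_mul_of_coprime ((hcop.pow_left a).pow 2 2), ← pow_mul,
      mul_comm a 2, ArithmeticFunction.sigma_one_apply_prime_pow hp, hd]
  have hE : (q + 1) * d * s = 2 * n ^ 2 := by
    refine Nat.eq_of_mul_eq_mul_left hq.pos ?_
    rw [hσn] at hperf
    linarith
  obtain ⟨w, hw⟩ : ∃ w, q + 1 = 2 * w := ⟨(q + 1) / 2, by omega⟩
  have hwds : w * d * s = n ^ 2 := by
    rw [hw] at hE
    linarith
  have hodd : Odd (w * d * s) := hwds ▸ hn.pow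
  have hs_odd : Odd s := (Nat.odd_mul.1 hodd).2
  have hd_odd : Odd d := (Nat.odd_mul.1 (Nat.odd_mul.1 hodd).1).2
  have hds : d * s < 2 * q := by
    by_contra! h
    have h1 := Nat.mul_le_mul_left (q + 1) h
    nlinarith
  obtain rfl := geom_sum_cofactor_eq_one hp hp2 hd_odd hd (by rw [hfac, hE]) hds hs_odd.pos.ne'
  rw [one_mul] at hd hds
  rw [mul_one, ← hfac, mul_pow, ← pow_mul, mul_comm a 2] at hE
  have hpq : p.Coprime (q + 1) := by
    rw [hp.coprime_iff_not_dvd, ← hd, sum_range_succ', add_assoc]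
    intro h
    have h2 := (Nat.dvd_add_right (dvd_sum fun i _ => dvd_pow_self p (Nat.succ_ne_zero i))).1 h
    exact hp2 ((Nat.prime_dvd_prime_iff_eq hp Nat.prime_two).1 (by simpa using h2))
  obtain ⟨e, he⟩ := (hpq.pow_left (2 * a)).dvd_of_dvd_mul_left
    (⟨2 * m ^ 2, by rw [hE]; ring⟩ : p ^ (2 * a) ∣ (q + 1) * s)
  have hp3 := hp.three_le hp2
  have hSlt := pred_mul_geom_sum_lt (k := 2 * a) hp3
  have hQ := pow_pos hp.pos (2 * a)
  have he1 : e = 1 := by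
    rw [hd] at hSlt
    have he_odd : Odd e := by
      rw [he] at hs_odd
      exact (Nat.odd_mul.1 hs_odd).2
    obtain ⟨v, rfl⟩ := he_odd
    by_contra h
    have hv : 1 ≤ v := by omega
    obtain ⟨t, rfl⟩ : ∃ t, p = t + 3 := ⟨p - 3, by omega⟩
    simp only [show t + 3 - 1 = t + 2 by omega] at hSlt
    have h3 : (t + 3) ^ (2 * a) * 3 ≤ (t + 3) ^ (2 * a) * (2 * v + 1) :=
      Nat.mul_le_mul_left _ (by omega)
    nlinarith [Nat.zero_le (t * (t + 3) ^ (2 * a))]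
  rw [he1, mul_one] at he
  refine sigma_sq_ne_prime_pow hp hp2 hm hap he ?_
  rw [hd]
  refine Nat.eq_of_mul_eq_mul_left hQ ?_
  rw [he] at hE
  linarith

theorem stmt_15 (N q n : ℕ) (hodd : Odd N) (hperf : ArithmeticFunction.sigma 1 N = 2 * N)
    (hq : q.Prime) (hq4 : q % 4 = 1)
    (hgcd : Nat.gcd q n = 1) (hN : N = q * n ^ 2) (hnq : n < q) :
    n < ArithmeticFunction.sigma 1 n ∧ ArithmeticFunction.sigma 1 n ≤ q ∧ q < ArithmeticFunction.sigma 1 q := by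
  subst hN
  have hn : Odd n := (Nat.odd_pow_iff two_ne_zero).1 (Nat.odd_mul.1 hodd).2
  exact absurd hnq (not_lt_of_perfect hq hq4 hn hgcd hperf)
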